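/- arXiv:2506.13868 — 3 statements merged into one kernel-verified Lean document; each statement's English description precedes it below -/
import Mathlib

section
/- In the polynomial ring ℂ[x₁,…,x₄₉] with variables H_α, H̄_α, Q^i_{a,α}, ũ^i_a, d̃^i_a, L^i_α, ẽ^i, the ideal I₃ generated by H₁, H₂, H̄₁, H̄₂, together with the four forms F_α = H_α + Σ_{i,a} d̃^i_a Q^i_{a,α} + Σᵢ Lⁱ_α ẽⁱ and F̄_α = H̄_α − Σ_{i,a} ũ^i_a Q^i_{a,α} (α = 1,2) is a prime complete intersection of height 8; equivalently its zero set is an irreducible affine variety of dimension 41 in ℂ⁴⁹. -/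
open MvPolynomial

/-- The 49 variables of the MSSM master space: `H_α`, `H̄_α`, `Q^i_{a,α}`,
`ũ^i_a`, `d̃^i_a`, `L^i_α`, `ẽ^i`. -/
abbrev Stmt8Var : Type :=
  Fin 2 ⊕ Fin 2 ⊕ (Fin 3 × Fin 3 × Fin 2) ⊕ (Fin 3 × Fin 3) ⊕
    (Fin 3 × Fin 3) ⊕ (Fin 3 × Fin 2) ⊕ Fin 3

noncomputable def s8H (α : Fin 2) : MvPolynomial Stmt8Var ℂ := X (Sum.inl α)
noncomputable def s8Hb (α : Fin 2) : MvPolynomial Stmt8Var ℂ :=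
  X (Sum.inr (Sum.inl α))
noncomputable def s8Q (i a : Fin 3) (α : Fin 2) : MvPolynomial Stmt8Var ℂ :=
  X (Sum.inr (Sum.inr (Sum.inl (i, a, α))))
noncomputable def s8u (i a : Fin 3) : MvPolynomial Stmt8Var ℂ :=
  X (Sum.inr (Sum.inr (Sum.inr (Sum.inl (i, a)))))
noncomputable def s8d (i a : Fin 3) : MvPolynomial Stmt8Var ℂ :=
  X (Sum.inr (Sum.inr (Sum.inr (Sum.inr (Sum.inl (i, a))))))
noncomputable def s8L (i : Fin 3) (α : Fin 2) : MvPolynomial Stmt8Var ℂ :=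
  X (Sum.inr (Sum.inr (Sum.inr (Sum.inr (Sum.inr (Sum.inl (i, α)))))))
noncomputable def s8e (i : Fin 3) : MvPolynomial Stmt8Var ℂ :=
  X (Sum.inr (Sum.inr (Sum.inr (Sum.inr (Sum.inr (Sum.inr i))))))

/-- `F_α = H_α + Σ_{i,a} d̃^i_a Q^i_{a,α} + Σᵢ Lⁱ_α ẽⁱ`. -/
noncomputable def s8F (α : Fin 2) : MvPolynomial Stmt8Var ℂ :=
  s8H α + (∑ i : Fin 3, ∑ a : Fin 3, s8d i a * s8Q i a α) +
    ∑ i : Fin 3, s8L i α * s8e i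

/-- `F̄_α = H̄_α − Σ_{i,a} ũ^i_a Q^i_{a,α}`. -/
noncomputable def s8Fb (α : Fin 2) : MvPolynomial Stmt8Var ℂ :=
  s8Hb α - ∑ i : Fin 3, ∑ a : Fin 3, s8u i a * s8Q i a α

/-- The ideal `I₃` of the third component of the master space. -/
noncomputable def s8I : Ideal (MvPolynomial Stmt8Var ℂ) :=
  Ideal.span {s8H 0, s8H 1, s8Hb 0, s8Hb 1, s8F 0, s8F 1, s8Fb 0, s8Fb 1}

/-- The affine-linear form `a₀ X₀ + a₁ X₁ + a₂ X₂ + b` in three new variables. -/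
noncomputable def affineForm {A : Type*} [CommRing A] (a : Fin 3 → A) (b : A) :
    MvPolynomial (Fin 3) A :=
  ∑ i, C (a i) * X i + C b

/-- The algebra obtained from `A` by adjoining a generic solution `X` of
`a₀ X₀ + a₁ X₁ + a₂ X₂ + b = 0`. -/
abbrev AffineExt {A : Type*} [CommRing A] (a : Fin 3 → A) (b : A) : Type _ :=
  MvPolynomial (Fin 3) A ⧸ Ideal.span {affineForm a b}

section AffineExt

variable {A : Type*} [CommRing A]

theorem map_affineForm {B : Type*} [CommRing B] (g : A →+* B) (a : Fin 3 → A) (b : A) :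
    map g (affineForm a b) = affineForm (g ∘ a) (g b) := by
  simp [affineForm]

/-- An affine-linear form is a nonzerodivisor as soon as one of its linear coefficients is. -/
theorem eq_zero_of_affineForm_mul_eq_zero {a : Fin 3 → A} {b : A} {i : Fin 3}
    (hi : ∀ x, a i * x = 0 → x = 0) {p : MvPolynomial (Fin 3) A}
    (hp : affineForm a b * p = 0) : p = 0 := by
  by_contra hne
  obtain ⟨m, hm, hmax⟩ := p.support.exists_max_image (fun m => m i)
    (by simpa [Finset.nonempty_iff_ne_empty] using hne)
  have hbig : ∀ n : Fin 3 →₀ ℕ, m i < n i → coeff n p = 0 := fun n hn => by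
    by_contra h
    exact absurd (hmax n (mem_support_iff.2 h)) (by simpa using hn)
  have hcoeff := congrArg (coeff (m + Finsupp.single i 1)) hp
  rw [affineForm, add_mul, Finset.sum_mul, coeff_add, coeff_sum, coeff_C_mul,
    hbig (m + Finsupp.single i 1) (by simp), Finset.sum_eq_single i] at hcoeff
  · rw [mul_assoc, coeff_C_mul, mul_comm (X i), coeff_mul_X] at hcoeff
    exact mem_support_iff.1 hm (hi _ (by simpa using hcoeff))
  · intro j _ hj
    rw [mul_assoc, coeff_C_mul, mul_comm (X j), coeff_mul_X']
    split_ifs with h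
    · rw [hbig, mul_zero]
      simp [hj]
    · simp
  · simp

theorem mem_map_C_of_affineForm_mul_mem {a : Fin 3 → A} {b : A} {J : Ideal A} {i : Fin 3}
    (hi : ∀ x, a i * x ∈ J → x ∈ J) {p : MvPolynomial (Fin 3) A}
    (hp : affineForm a b * p ∈ J.map C) : p ∈ J.map (C : A →+* MvPolynomial (Fin 3) A) := by
  have hker : J.map (C : A →+* MvPolynomial (Fin 3) A) =
      RingHom.ker (map (σ := Fin 3) (Ideal.Quotient.mk J)) := by
    rw [ker_map, Ideal.mk_ker]
  rw [hker, RingHom.mem_ker] at hp ⊢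
  rw [map_mul, map_affineForm] at hp
  refine eq_zero_of_affineForm_mul_eq_zero (i := i) (fun x hx => ?_) hp
  obtain ⟨x, rfl⟩ := Ideal.Quotient.mk_surjective x
  rw [Function.comp_apply, ← map_mul, Ideal.Quotient.eq_zero_iff_mem] at hx
  exact Ideal.Quotient.eq_zero_iff_mem.2 (hi x hx)

theorem mul_mem_map_C_imp {c : A} {J : Ideal A} (hc : ∀ x, c * x ∈ J → x ∈ J)
    {p : MvPolynomial (Fin 3) A} (hp : C c * p ∈ J.map C) :
    p ∈ J.map (C : A →+* MvPolynomial (Fin 3) A) := by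
  rw [mem_map_C_iff] at hp ⊢
  exact fun m => hc _ (by simpa using hp m)

variable {a : Fin 3 → A} {b : A}

theorem mem_span_affineForm_of_C_mul_mem [IsDomain A] (h0 : a 0 ≠ 0)
    (h1 : ∀ x, a 1 * x ∈ Ideal.span {a 0} → x ∈ Ideal.span {a 0})
    {p : MvPolynomial (Fin 3) A} (hp : C (a 0) * p ∈ Ideal.span {affineForm a b}) :
    p ∈ Ideal.span {affineForm a b} := by
  obtain ⟨q, hq⟩ := Ideal.mem_span_singleton.1 hp
  have hmem : q ∈ (Ideal.span {a 0}).map (C : A →+* MvPolynomial (Fin 3) A) := by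
    refine mem_map_C_of_affineForm_mul_mem (i := 1) h1 (b := b) ?_
    rw [Ideal.map_span, Set.image_singleton, ← hq]
    exact Ideal.mem_span_singleton.2 (dvd_mul_right _ _)
  rw [Ideal.map_span, Set.image_singleton] at hmem
  obtain ⟨r, rfl⟩ := Ideal.mem_span_singleton.1 hmem
  refine Ideal.mem_span_singleton.2 ⟨r, mul_left_cancel₀ ((C_ne_zero (σ := Fin 3)).2 h0) ?_⟩
  rw [hq]; ring

/-- Modulo `a₀ X₀ + a₁ X₁ + a₂ X₂ + b`, the variable `X₀` can be eliminated after multiplying by a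
power of `a₀`. -/
theorem exists_pow_mul_sub_mem_span_affineForm [IsDomain A]
    (g : MvPolynomial (Fin 3) A →+* MvPolynomial (Fin 3) (FractionRing A))
    (hC : ∀ x, g (C x) = C (algebraMap A (FractionRing A) x))
    (hX : ∀ i, i ≠ 0 → g (X i) = X i) (p : MvPolynomial (Fin 3) A) :
    ∃ (n : ℕ) (p' : MvPolynomial (Fin 3) A), g p' = map (algebraMap A (FractionRing A)) p' ∧
      C (a 0) ^ n * p - p' ∈ Ideal.span {affineForm a b} := by
  induction p using MvPolynomial.induction_on with
  | C x => exact ⟨0, C x, by simp [hC], by simp⟩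
  | add p q hp hq =>
    obtain ⟨n, p', hp', hpn⟩ := hp
    obtain ⟨m, q', hq', hqm⟩ := hq
    refine ⟨n + m, C (a 0) ^ m * p' + C (a 0) ^ n * q', by simp [hp', hq', hC], ?_⟩
    convert! add_mem (Ideal.mul_mem_left _ (C (a 0) ^ m) hpn)
      (Ideal.mul_mem_left _ (C (a 0) ^ n) hqm) using 1
    ring
  | mul_X p i hp =>
    obtain ⟨n, p', hp', hpn⟩ := hp
    by_cases hi : i = 0
    · subst hi
      refine ⟨n + 1, -(p' * (C (a 1) * X 1 + C (a 2) * X 2 + C b)), by simp [hp', hC, hX], ?_⟩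
      convert! add_mem (Ideal.mul_mem_left _ (C (a 0) * X 0) hpn)
        (Ideal.mul_mem_left _ p' (Ideal.mem_span_singleton_self (affineForm a b))) using 1
      simp only [affineForm, Fin.sum_univ_three]
      ring
    · refine ⟨n, p' * X i, by simp [hp', hX i hi], ?_⟩
      convert! Ideal.mul_mem_left _ (X i) hpn using 1
      ring

theorem isPrime_span_affineForm [IsDomain A] (h0 : a 0 ≠ 0)
    (h1 : ∀ x, a 1 * x ∈ Ideal.span {a 0} → x ∈ Ideal.span {a 0}) :
    (Ideal.span {affineForm a b}).IsPrime := by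
  set φ := algebraMap A (FractionRing A)
  have hφ : Function.Injective φ := IsFractionRing.injective A _
  let g : MvPolynomial (Fin 3) A →+* MvPolynomial (Fin 3) (FractionRing A) :=
    eval₂Hom (C.comp φ)
      ![-(C (φ (a 0))⁻¹ * (C (φ (a 1)) * X 1 + C (φ (a 2)) * X 2 + C (φ b))), X 1, X 2]
  have hC : ∀ x, g (C x) = C (φ x) := fun x => by simp [g]
  have hX : ∀ i, i ≠ 0 → g (X i) = X i := by
    intro i hi
    fin_cases i <;> simp_all [g]
  have hf : g (affineForm a b) = 0 := by
    have hinv : C (φ (a 0)) * C (φ (a 0))⁻¹ = (1 : MvPolynomial (Fin 3) (FractionRing A)) := by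
      rw [← C_mul, mul_inv_cancel₀ ((map_ne_zero_iff φ hφ).2 h0), C_1]
    have hX0 : g (X 0) =
        -(C (φ (a 0))⁻¹ * (C (φ (a 1)) * X 1 + C (φ (a 2)) * X 2 + C (φ b))) := by simp [g]
    simp only [affineForm, Fin.sum_univ_three, map_add, map_mul, hC, hX0, hX 1 (by decide),
      hX 2 (by decide)]
    linear_combination (-(C (φ (a 1)) * X 1 + C (φ (a 2)) * X 2 + C (φ b))) * hinv
  have hker : Ideal.span {affineForm a b} = RingHom.ker g := by
    refine le_antisymm ((Ideal.span_singleton_le_iff_mem _).2 hf) fun p hp => ?_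
    obtain ⟨n, p', hp', hmem⟩ := exists_pow_mul_sub_mem_span_affineForm (b := b) g hC hX p
    have hgz : g (C (a 0) ^ n * p - p') = 0 :=
      (Ideal.span_singleton_le_iff_mem (RingHom.ker g)).2 hf hmem
    rw [map_sub, map_mul, RingHom.mem_ker.1 hp, mul_zero, zero_sub, neg_eq_zero, hp'] at hgz
    rw [(map_eq_zero_iff _ (map_injective _ hφ)).1 hgz, sub_zero] at hmem
    induction n with
    | zero => simpa using hmem
    | succ n ih =>
      exact ih (mem_span_affineForm_of_C_mul_mem h0 h1 (by rwa [← mul_assoc, ← pow_succ']))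
  rw [hker]
  exact RingHom.ker_isPrime g

theorem isDomain_affineExt [IsDomain A] (h0 : a 0 ≠ 0)
    (h1 : ∀ x, a 1 * x ∈ Ideal.span {a 0} → x ∈ Ideal.span {a 0}) :
    IsDomain (AffineExt a b) :=
  have := isPrime_span_affineForm (b := b) h0 h1
  Ideal.Quotient.isDomain _

theorem affineExt_mk_ne_zero [IsDomain A] (h0 : a 0 ≠ 0)
    (h1 : ∀ x, a 1 * x ∈ Ideal.span {a 0} → x ∈ Ideal.span {a 0}) :
    (Ideal.Quotient.mk (Ideal.span {affineForm a b}) (C (a 0)) : AffineExt a b) ≠ 0 := by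
  intro h
  have hone : (1 : MvPolynomial (Fin 3) A) ∈ Ideal.span {affineForm a b} :=
    mem_span_affineForm_of_C_mul_mem h0 h1
      (by rw [mul_one]; exact Ideal.Quotient.eq_zero_iff_mem.1 h)
  exact (isPrime_span_affineForm h0 h1).ne_top ((Ideal.eq_top_iff_one _).2 hone)

theorem affineExt_mem_span_of_mul_mem [IsDomain A]
    (h1 : ∀ x, a 1 * x ∈ Ideal.span {a 0} → x ∈ Ideal.span {a 0})
    (h2 : ∀ x, a 2 * x ∈ Ideal.span {a 0, a 1} → x ∈ Ideal.span {a 0, a 1})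
    (x : AffineExt a b)
    (hx : (Ideal.Quotient.mk _ (C (a 1)) : AffineExt a b) * x ∈
      Ideal.span {(Ideal.Quotient.mk _ (C (a 0)) : AffineExt a b)}) :
    x ∈ Ideal.span {(Ideal.Quotient.mk _ (C (a 0)) : AffineExt a b)} := by
  obtain ⟨p, rfl⟩ := Ideal.Quotient.mk_surjective x
  obtain ⟨y, hy⟩ := Ideal.mem_span_singleton.1 hx
  obtain ⟨q, rfl⟩ := Ideal.Quotient.mk_surjective y
  rw [← map_mul, ← map_mul, Ideal.Quotient.mk_eq_mk_iff_sub_mem] at hy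
  obtain ⟨r, hr⟩ := Ideal.mem_span_singleton.1 hy
  have hmap : (Ideal.span {a 0, a 1}).map (C : A →+* MvPolynomial (Fin 3) A) =
      Ideal.span {C (a 0), C (a 1)} := by rw [Ideal.map_span, Set.image_pair]
  have hmem : r ∈ (Ideal.span {a 0, a 1}).map (C : A →+* MvPolynomial (Fin 3) A) := by
    refine mem_map_C_of_affineForm_mul_mem (i := 2) h2 (b := b) ?_
    rw [hmap, ← hr]
    exact Ideal.mem_span_pair.2 ⟨-q, p, by ring⟩
  rw [hmap] at hmem
  obtain ⟨r₀, r₁, rfl⟩ := Ideal.mem_span_pair.1 hmem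
  have hdvd : p - affineForm a b * r₁ ∈
      (Ideal.span {a 0}).map (C : A →+* MvPolynomial (Fin 3) A) := by
    refine mul_mem_map_C_imp h1 ?_
    rw [Ideal.map_span, Set.image_singleton]
    exact Ideal.mem_span_singleton.2 ⟨q + affineForm a b * r₀, by linear_combination hr⟩
  rw [Ideal.map_span, Set.image_singleton] at hdvd
  obtain ⟨s, hs⟩ := Ideal.mem_span_singleton.1 hdvd
  refine Ideal.mem_span_singleton.2 ⟨Ideal.Quotient.mk _ s, ?_⟩
  rw [← map_mul, Ideal.Quotient.mk_eq_mk_iff_sub_mem]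
  exact Ideal.mem_span_singleton.2 ⟨r₁, by linear_combination hs⟩

end AffineExt

theorem mem_span_X_image_of_X_mul_mem {σ A : Type*} [CommRing A] {s : Set σ} {k : σ} (hk : k ∉ s)
    {p : MvPolynomial σ A} (hp : X k * p ∈ Ideal.span (X '' s)) : p ∈ Ideal.span (X '' s) := by
  rw [mem_ideal_span_X_image] at hp ⊢
  intro m hm
  obtain ⟨i, hi, hne⟩ := hp (Finsupp.single k 1 + m) (by
    rw [mem_support_iff, coeff_X_mul]; exact mem_support_iff.1 hm)
  refine ⟨i, hi, ?_⟩
  have hki : k ≠ i := fun h => hk (h ▸ hi)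
  simpa [Finsupp.single_apply, hki] using hne

/-- Adjoining generic solutions of two affine-linear equations whose linear coefficients are the
same three variables of a polynomial ring over a domain yields a domain. -/
theorem isDomain_affineExt_affineExt {σ A : Type*} [CommRing A] [IsDomain A]
    {v : Fin 3 → σ} (hv : Function.Injective v) (b : MvPolynomial σ A)
    (b' : AffineExt (fun i => X (v i)) b) :
    IsDomain (AffineExt (A := AffineExt (fun i => X (v i)) b)
      (fun i => Ideal.Quotient.mk _ (C (X (v i)))) b') := by
  have h0 : (X (v 0) : MvPolynomial σ A) ≠ 0 := X_ne_zero _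
  have h1 : ∀ x : MvPolynomial σ A,
      X (v 1) * x ∈ Ideal.span {X (v 0)} → x ∈ Ideal.span {X (v 0)} := fun x hx => by
    rw [← Set.image_singleton] at hx ⊢
    exact mem_span_X_image_of_X_mul_mem (by simp [hv.eq_iff]) hx
  have h2 : ∀ x : MvPolynomial σ A,
      X (v 2) * x ∈ Ideal.span {X (v 0), X (v 1)} → x ∈ Ideal.span {X (v 0), X (v 1)} :=
    fun x hx => by
      rw [← Set.image_pair] at hx ⊢
      exact mem_span_X_image_of_X_mul_mem (by simp [hv.eq_iff]) hx
  have := isDomain_affineExt (a := fun i => (X (v i) : MvPolynomial σ A)) (b := b) h0 h1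
  exact isDomain_affineExt
    (affineExt_mk_ne_zero (a := fun i => (X (v i) : MvPolynomial σ A)) (b := b) h0 h1)
    (affineExt_mem_span_of_mul_mem (a := fun i => (X (v i) : MvPolynomial σ A)) (b := b) h1 h2)

theorem apply_affineForm {A B : Type*} [CommRing A] [CommRing B]
    (g : MvPolynomial (Fin 3) A →+* B) (a : Fin 3 → A) (b : A) :
    g (affineForm a b) = ∑ i, g (C (a i)) * g (X i) + g (C b) := by
  simp [affineForm]

theorem sum_mk_C_mul_mk_X_add {A : Type*} [CommRing A] (a : Fin 3 → A) (b : A) :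
    ∑ i, (Ideal.Quotient.mk _ (C (a i)) : AffineExt a b) * Ideal.Quotient.mk _ (X i) +
      Ideal.Quotient.mk _ (C b) = 0 := by
  have h : (Ideal.Quotient.mk _ (affineForm a b) : AffineExt a b) = 0 :=
    Ideal.Quotient.eq_zero_iff_mem.2 (Ideal.mem_span_singleton_self _)
  exact (apply_affineForm _ a b).symm.trans h

theorem exists_affineExt_lift {A S : Type*} [CommRing A] [CommRing S] (a : Fin 3 → A) (b : A)
    (g : A →+* S) (y : Fin 3 → S) (h : ∑ i, g (a i) * y i + g b = 0) :
    ∃ θ : AffineExt a b →+* S, (∀ x, θ (Ideal.Quotient.mk _ (C x)) = g x) ∧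
      ∀ i, θ (Ideal.Quotient.mk _ (X i)) = y i := by
  refine ⟨Ideal.Quotient.lift _ (eval₂Hom g y) fun p hp => ?_, fun x => by simp, fun i => by simp⟩
  obtain ⟨q, rfl⟩ := Ideal.mem_span_singleton.1 hp
  rw [map_mul]
  simp [affineForm, h]

/-- Over a polynomial ring over a domain, the universal algebra in which two affine-linear equations
with the same three variables as linear coefficients are solved is a domain. -/
theorem exists_isDomain_universal_solution {σ A : Type} [CommRing A] [IsDomain A]
    {v : Fin 3 → σ} (hv : Function.Injective v) (b : Fin 2 → MvPolynomial σ A) :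
    ∃ (D : Type) (_ : CommRing D) (_ : IsDomain D) (ι : MvPolynomial σ A →+* D)
      (x : Fin 2 → Fin 3 → D), (∀ α, ∑ i, ι (X (v i)) * x α i + ι (b α) = 0) ∧
      ∀ (S : Type) [CommRing S] (g : MvPolynomial σ A →+* S) (y : Fin 2 → Fin 3 → S),
        (∀ α, ∑ i, g (X (v i)) * y α i + g (b α) = 0) →
        ∃ θ : D →+* S, (∀ p, θ (ι p) = g p) ∧ ∀ α i, θ (x α i) = y α i := by
  let a : Fin 3 → MvPolynomial σ A := fun i => X (v i)
  let j : MvPolynomial σ A →+* AffineExt a (b 0) := (Ideal.Quotient.mk _).comp C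
  let j' : AffineExt a (b 0) →+* AffineExt (fun i => j (a i)) (j (b 1)) :=
    (Ideal.Quotient.mk _).comp C
  refine ⟨AffineExt (fun i => j (a i)) (j (b 1)), inferInstance,
    isDomain_affineExt_affineExt hv (b 0) (j (b 1)), j'.comp j,
    ![fun i => j' (Ideal.Quotient.mk _ (X i)), fun i => Ideal.Quotient.mk _ (X i)],
    fun α => ?_, fun S _ g y h => ?_⟩
  · fin_cases α
    · have := congrArg j' (sum_mk_C_mul_mk_X_add a (b 0))
      simp only [map_add, map_sum, map_mul, map_zero] at this
      exact this
    · exact sum_mk_C_mul_mk_X_add (fun i => j (a i)) (j (b 1))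
  · obtain ⟨θ, hθC, hθX⟩ := exists_affineExt_lift a (b 0) g (y 0) (h 0)
    have hθj : ∀ p, θ (j p) = g p := hθC
    obtain ⟨θ', hC, hX⟩ := exists_affineExt_lift (fun i => j (a i)) (j (b 1)) θ (y 1)
      (by simpa only [hθj] using h 1)
    refine ⟨θ', fun p => (hC _).trans (hθC p), fun α i => ?_⟩
    fin_cases α
    · exact (hC _).trans (hθX i)
    · exact hX i

section Height

variable {σ k : Type*} [Field k] (P : Ideal (MvPolynomial σ k))

open Classical in
/-- Reduction modulo `P` of all the variables outside `U`, the variables in `U` being kept free. -/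
noncomputable def reduceOutside (U : Finset σ) :
    MvPolynomial σ k →ₐ[k] MvPolynomial σ (MvPolynomial σ k ⧸ P) :=
  aeval fun x => if x ∈ U then X x else C (Ideal.Quotient.mk P (X x))

theorem reduceOutside_eq_C {S U : Finset σ} (hU : U ⊆ S) {p : MvPolynomial σ k}
    (hp : p ∈ supported k (S : Set σ)ᶜ) :
    reduceOutside P U p = C (Ideal.Quotient.mk P p) := by
  rw [supported] at hp
  induction hp using Algebra.adjoin_induction with
  | mem x hx =>
    obtain ⟨i, hi, rfl⟩ := hx
    have hiU : i ∉ U := fun h => hi (hU h)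
    simp [reduceOutside, hiU]
  | algebraMap r =>
    rw [AlgHom.commutes, IsScalarTower.algebraMap_apply k (MvPolynomial σ k ⧸ P)]
    rfl
  | add p q _ _ hp hq => simp [hp, hq]
  | mul p q _ _ hp hq => simp [hp, hq]

open Classical in
theorem ker_reduceOutside_lt {S U : Finset σ} (hU : U ⊆ S) {i : σ} (hi : i ∈ U)
    {s b : MvPolynomial σ k} (hsP : s ∉ P) (hs : s ∈ supported k (S : Set σ)ᶜ)
    (hb : b ∈ supported k (S : Set σ)ᶜ) (hP : s * X i + b ∈ P) :
    RingHom.ker (reduceOutside P U) < RingHom.ker (reduceOutside P (U.erase i)) := by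
  let ψ : MvPolynomial σ (MvPolynomial σ k ⧸ P) →ₐ[k] MvPolynomial σ (MvPolynomial σ k ⧸ P) :=
    (aeval fun x => if x = i then C (Ideal.Quotient.mk P (X x)) else X x :
      _ →ₐ[MvPolynomial σ k ⧸ P] _).restrictScalars k
  have hψ : reduceOutside P (U.erase i) = ψ.comp (reduceOutside P U) := by
    refine MvPolynomial.algHom_ext fun x => ?_
    by_cases hx : x = i
    · subst hx; simp [reduceOutside, ψ, hi]
    · by_cases hxU : x ∈ U <;> simp [reduceOutside, ψ, hx, hxU]
  refine lt_of_le_of_ne (fun p hp => ?_) fun h => ?_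
  · rw [RingHom.mem_ker] at hp ⊢
    rw [hψ, AlgHom.comp_apply, hp, map_zero]
  · have hmem : s * X i + b ∈ RingHom.ker (reduceOutside P (U.erase i)) := by
      rw [RingHom.mem_ker, map_add, map_mul,
        reduceOutside_eq_C P ((U.erase_subset i).trans hU) hs,
        reduceOutside_eq_C P ((U.erase_subset i).trans hU) hb]
      simpa [reduceOutside, ← C_mul, ← C_add, ← map_mul, ← map_add] using
        Ideal.Quotient.eq_zero_iff_mem.2 hP
    rw [← h, RingHom.mem_ker, map_add, map_mul, reduceOutside_eq_C P hU hs,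
      reduceOutside_eq_C P hU hb] at hmem
    have hcoeff := congrArg (coeff (Finsupp.single i 1)) hmem
    have hne : (0 : σ →₀ ℕ) ≠ Finsupp.single i 1 := by
      simp [eq_comm]
    simp only [reduceOutside, aeval_X, if_pos hi, coeff_add, coeff_C_mul, coeff_X, coeff_C,
      if_neg hne, coeff_zero] at hcoeff
    exact hsP (Ideal.Quotient.eq_zero_iff_mem.1 (by simpa using hcoeff))

/-- A prime ideal of a polynomial ring which determines generically each of the variables in `S` as
a rational function of the variables outside `S` has height at least the cardinality of `S`. -/
theorem card_le_height_of_solvable [P.IsPrime] (S : Finset σ)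
    (h : ∀ i ∈ S, ∃ s b, s ∉ P ∧ s ∈ supported k (S : Set σ)ᶜ ∧ b ∈ supported k (S : Set σ)ᶜ ∧
      s * X i + b ∈ P) :
    (S.card : ℕ∞) ≤ P.height := by
  classical
  have key : ∀ T ⊆ S, (T.card : ℕ∞) ≤ (RingHom.ker (reduceOutside P (S \ T))).height := by
    intro T
    induction T using Finset.induction_on with
    | empty => simp
    | insert i T hiT ih =>
      intro hT
      obtain ⟨s, b, hsP, hs, hb, hP⟩ := h i (hT (Finset.mem_insert_self i T))
      have hlt := ker_reduceOutside_lt P (U := S \ T) Finset.sdiff_subset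
        (Finset.mem_sdiff.2 ⟨hT (Finset.mem_insert_self i T), hiT⟩) hsP hs hb hP
      rw [← Finset.sdiff_insert] at hlt
      have := RingHom.ker_isPrime (reduceOutside P (S \ T))
      have := RingHom.ker_isPrime (reduceOutside P (S \ insert i T))
      rw [Finset.card_insert_of_notMem hiT, Nat.cast_add, Nat.cast_one]
      exact (add_le_add_left (ih ((Finset.subset_insert i T).trans hT)) 1).trans
        (Ideal.height_add_one_le_of_lt_of_isPrime hlt)
  have hker : RingHom.ker (reduceOutside P (S \ S)) = P := by
    ext p
    rw [RingHom.mem_ker, reduceOutside_eq_C (S := ∅) P (by simp) (by simp), C_eq_zero,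
      Ideal.Quotient.eq_zero_iff_mem]
  simpa only [hker] using key S subset_rfl

end Height

theorem ringKrullDim_quotient_add_height_le {R : Type*} [CommRing R] (P : Ideal R)
    [hP : P.IsPrime] :
    ringKrullDim (R ⧸ P) + (P.height : WithBot ℕ∞) ≤ ringKrullDim R := by
  have hIci : PrimeSpectrum.zeroLocus (P : Set R) = Set.Ici (⟨P, hP⟩ : PrimeSpectrum R) := by
    ext q; rfl
  have : Nonempty (PrimeSpectrum R) := ⟨⟨P, hP⟩⟩
  rw [ringKrullDim_quotient, hIci, ← Order.coheight_eq_krullDim_Ici, ringKrullDim,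
    Order.krullDim_eq_iSup_height_add_coheight_of_nonempty,
    show P.height = _ from PrimeSpectrum.height_eq_orderHeight ⟨P, hP⟩, ← WithBot.coe_add, add_comm]
  exact WithBot.coe_le_coe.2 (le_iSup (fun q : PrimeSpectrum R => Order.height q + Order.coheight q)
    ⟨P, hP⟩)

theorem s8F_eq (α : Fin 2) : s8F α = s8H α + ((∑ i : Fin 3, s8e i * s8L i α) +
    ∑ i : Fin 3, ∑ a : Fin 3, s8d i a * s8Q i a α) := by
  rw [s8F, add_assoc, add_comm (∑ i : Fin 3, ∑ a : Fin 3, s8d i a * s8Q i a α)]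
  simp only [mul_comm (s8L _ _)]

theorem s8I_isPrime : s8I.IsPrime := by
  obtain ⟨D, _, _, ι, x, hx, hD⟩ := exists_isDomain_universal_solution (A := ℂ)
    (v := fun i : Fin 3 => (Sum.inr (Sum.inr (Sum.inr (Sum.inl (0, i)))) : Stmt8Var))
    (fun i j h => by simpa using h)
    (fun α => ∑ i : Fin 2, ∑ a : Fin 3, s8u i.succ a * s8Q i.succ a α)
  let φ : MvPolynomial Stmt8Var ℂ →+* D := eval₂Hom (ι.comp C) fun t => match t with
    | Sum.inr (Sum.inr (Sum.inl (0, a, α))) => x α a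
    | t => ι (X t)
  obtain ⟨E, _, _, κ, y, hy, hE⟩ := exists_isDomain_universal_solution (A := D)
    (v := (id : Fin 3 → Fin 3)) Function.injective_id
    (fun α => C (φ (∑ i : Fin 3, ∑ a : Fin 3, s8d i a * s8Q i a α)))
  let ψ : MvPolynomial Stmt8Var ℂ →+* E := eval₂Hom ((κ.comp C).comp (φ.comp C)) fun t =>
    match t with
    | Sum.inl _ => 0
    | Sum.inr (Sum.inl _) => 0
    | Sum.inr (Sum.inr (Sum.inr (Sum.inr (Sum.inr (Sum.inl (i, α)))))) => y α i
    | Sum.inr (Sum.inr (Sum.inr (Sum.inr (Sum.inr (Sum.inr i))))) => κ (X i)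
    | t => κ (C (φ (X t)))
  have hψH : ∀ α, ψ (s8H α) = 0 := fun α => by simp [ψ, s8H]
  have hψHb : ∀ α, ψ (s8Hb α) = 0 := fun α => by simp [ψ, s8Hb]
  have hψQ : ∀ i a α, ψ (s8Q i a α) = κ (C (φ (s8Q i a α))) := fun i a α => by simp [ψ, s8Q]
  have hψu : ∀ i a, ψ (s8u i a) = κ (C (φ (s8u i a))) := fun i a => by simp [ψ, s8u]
  have hψd : ∀ i a, ψ (s8d i a) = κ (C (φ (s8d i a))) := fun i a => by simp [ψ, s8d]
  have hψL : ∀ i α, ψ (s8L i α) = y α i := fun i α => by simp [ψ, s8L]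
  have hψe : ∀ i, ψ (s8e i) = κ (X i) := fun i => by simp [ψ, s8e]
  have hφQ0 : ∀ a α, φ (s8Q 0 a α) = x α a := fun a α => by simp [φ, s8Q]
  have hφQs : ∀ (i : Fin 2) a α, φ (s8Q i.succ a α) = ι (s8Q i.succ a α) := fun i a α => by
    fin_cases i <;> simp [φ, s8Q]
  have hφu : ∀ i a, φ (s8u i a) = ι (s8u i a) := fun i a => by simp [φ, s8u]
  have hφg : ∀ α, φ (∑ i : Fin 3, ∑ a : Fin 3, s8u i a * s8Q i a α) = 0 := fun α => by
    rw [← hx α, Fin.sum_univ_succ]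
    simp only [map_add, map_sum, map_mul, hφQ0, hφQs, hφu]
    rfl
  have hψF : ∀ α, ψ (s8F α) = 0 := fun α => by
    rw [← hy α, s8F_eq, map_add, hψH, zero_add]
    simp only [map_add, map_sum, map_mul, hψQ, hψd, hψL, hψe, id]
  have hψFb : ∀ α, ψ (s8Fb α) = 0 := fun α => by
    have := congrArg (fun z => κ (C z)) (hφg α)
    simp only [map_sum, map_mul, map_zero] at this
    simp only [s8Fb, map_sub, map_sum, map_mul, hψHb, hψQ, hψu, this, sub_zero]
  have hle : s8I ≤ RingHom.ker ψ := by
    rw [s8I, Ideal.span_le]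
    rintro p (rfl | rfl | rfl | rfl | rfl | rfl | rfl | rfl) <;>
      simp only [SetLike.mem_coe, RingHom.mem_ker, hψH, hψHb, hψF, hψFb]
  let π := Ideal.Quotient.mk s8I
  have hmem : ∀ p ∈ ({s8H 0, s8H 1, s8Hb 0, s8Hb 1, s8F 0, s8F 1, s8Fb 0, s8Fb 1} :
      Set (MvPolynomial Stmt8Var ℂ)), π p = 0 := fun p hp =>
    Ideal.Quotient.eq_zero_iff_mem.2 (Ideal.subset_span hp)
  have hπH : ∀ α, π (s8H α) = 0 := fun α => hmem _ (by fin_cases α <;> simp)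
  have hπHb : ∀ α, π (s8Hb α) = 0 := fun α => hmem _ (by fin_cases α <;> simp)
  have hπF : ∀ α, π (s8F α) = 0 := fun α => hmem _ (by fin_cases α <;> simp)
  have hπFb : ∀ α, π (s8Fb α) = 0 := fun α => hmem _ (by fin_cases α <;> simp)
  obtain ⟨θ, hθι, hθx⟩ := hD _ π (fun α a => π (s8Q 0 a α)) fun α => by
    have := hπFb α
    rw [s8Fb, map_sub, hπHb, zero_sub, neg_eq_zero, Fin.sum_univ_succ] at this
    simp only [map_add, map_sum, map_mul] at this ⊢
    exact this
  have hθφ : ∀ p, θ (φ p) = π p := by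
    refine RingHom.congr_fun (f := θ.comp φ) (g := π) (MvPolynomial.ringHom_ext ?_ ?_)
    · intro r; simp [φ, hθι]
    · intro t
      rw [RingHom.comp_apply]
      simp only [φ, coe_eval₂Hom, eval₂_X]
      split
      · exact hθx _ _
      · exact hθι _
  obtain ⟨Θ, hΘκ, hΘy⟩ := hE _ (eval₂Hom θ fun i => π (s8e i)) (fun α i => π (s8L i α)) fun α => by
    have := hπF α
    rw [s8F_eq, map_add, hπH, zero_add] at this
    simp only [coe_eval₂Hom, eval₂_X, eval₂_C, hθφ, id]
    simpa only [map_add, map_sum, map_mul] using this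
  have hΘψ : ∀ p, Θ (ψ p) = π p := by
    refine RingHom.congr_fun (f := Θ.comp ψ) (g := π) (MvPolynomial.ringHom_ext ?_ ?_)
    · intro r
      rw [RingHom.comp_apply, ← hθφ]
      simp [ψ, hΘκ]
    · intro t
      rw [RingHom.comp_apply]
      simp only [ψ, coe_eval₂Hom, eval₂_X]
      split
      · rw [map_zero]; exact (hπH _).symm
      · rw [map_zero]; exact (hπHb _).symm
      · exact hΘy _ _
      · rw [hΘκ]; simp [s8e]
      · rw [hΘκ]; simp [hθφ]
  have hker : s8I = RingHom.ker ψ := le_antisymm hle fun p hp =>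
    Ideal.Quotient.eq_zero_iff_mem.1 <| by
      rw [← show Θ (ψ p) = Ideal.Quotient.mk s8I p from hΘψ p, RingHom.mem_ker.1 hp, map_zero]
  rw [hker]
  exact RingHom.ker_isPrime ψ

theorem s8I_eq_span_range : s8I = Ideal.span (Set.range
    ![s8H 0, s8H 1, s8Hb 0, s8Hb 1, s8F 0, s8F 1, s8Fb 0, s8Fb 1]) := by
  simp only [s8I, Matrix.range_cons, Matrix.range_empty, Set.union_empty, Set.singleton_union]

theorem encard_range_le {α : Type*} {n : ℕ} (f : Fin n → α) : (Set.range f).encard ≤ n := by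
  rw [← Set.image_univ]
  exact (Set.encard_image_le f Set.univ).trans (by simp)

theorem s8I_le_ker_aeval (c : Stmt8Var → ℂ) (hH : ∀ α, c (Sum.inl α) = 0)
    (hHb : ∀ α, c (Sum.inr (Sum.inl α)) = 0)
    (hQ : ∀ i a α, c (Sum.inr (Sum.inr (Sum.inl (i, a, α)))) = 0)
    (hL : ∀ i α, c (Sum.inr (Sum.inr (Sum.inr (Sum.inr (Sum.inr (Sum.inl (i, α))))))) = 0) :
    s8I ≤ RingHom.ker (aeval c : MvPolynomial Stmt8Var ℂ →ₐ[ℂ] ℂ) := by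
  rw [s8I, Ideal.span_le]
  rintro p (rfl | rfl | rfl | rfl | rfl | rfl | rfl | rfl) <;>
    simp [s8H, s8Hb, s8F, s8Fb, s8Q, s8L, hH, hHb, hQ, hL]

theorem s8u_notMem (i a : Fin 3) : s8u i a ∉ s8I := fun h => by
  have := s8I_le_ker_aeval (Pi.single (Sum.inr (Sum.inr (Sum.inr (Sum.inl (i, a))))) 1)
    (by simp) (by simp) (by simp) (by simp) h
  simp [s8u] at this

theorem s8e_notMem (i : Fin 3) : s8e i ∉ s8I := fun h => by
  have := s8I_le_ker_aeval
    (Pi.single (Sum.inr (Sum.inr (Sum.inr (Sum.inr (Sum.inr (Sum.inr i)))))) 1)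
    (by simp) (by simp) (by simp) (by simp) h
  simp [s8e] at this

/-- The eight variables `H_α`, `H̄_α`, `Q⁰_{0,α}`, `L⁰_α` for which the equations are solved. -/
def s8Solved : Finset Stmt8Var :=
  Finset.univ.image fun x : Fin 4 × Fin 2 =>
    (![Sum.inl x.2, Sum.inr (Sum.inl x.2), Sum.inr (Sum.inr (Sum.inl (0, 0, x.2))),
      Sum.inr (Sum.inr (Sum.inr (Sum.inr (Sum.inr (Sum.inl (0, x.2))))))] : Fin 4 → Stmt8Var) x.1

theorem card_s8Solved : s8Solved.card = 8 := by decide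

theorem X_mem_supported_compl_s8Solved {x : Stmt8Var} (hx : x ∉ s8Solved) :
    (X x : MvPolynomial Stmt8Var ℂ) ∈ supported ℂ (s8Solved : Set Stmt8Var)ᶜ :=
  X_mem_supported.2 (by simpa using hx)

theorem eight_le_height_s8I : 8 ≤ s8I.height := by
  have := s8I_isPrime
  have hgen : ∀ p ∈ ({s8H 0, s8H 1, s8Hb 0, s8Hb 1, s8F 0, s8F 1, s8Fb 0, s8Fb 1} :
      Set (MvPolynomial Stmt8Var ℂ)), p ∈ s8I := fun p hp => Ideal.subset_span hp
  have hH : ∀ α, s8H α ∈ s8I := fun α => hgen _ (by fin_cases α <;> simp)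
  have hHb : ∀ α, s8Hb α ∈ s8I := fun α => hgen _ (by fin_cases α <;> simp)
  have hF : ∀ α, s8F α ∈ s8I := fun α => hgen _ (by fin_cases α <;> simp)
  have hFb : ∀ α, s8Fb α ∈ s8I := fun α => hgen _ (by fin_cases α <;> simp)
  have hone : (1 : MvPolynomial Stmt8Var ℂ) ∉ s8I := (Ideal.ne_top_iff_one _).1 this.ne_top
  have hu : ∀ i a, s8u i a ∈ supported ℂ (s8Solved : Set Stmt8Var)ᶜ := fun i a =>
    X_mem_supported_compl_s8Solved (by simp [s8Solved, Fin.forall_fin_succ])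
  have he : ∀ i, s8e i ∈ supported ℂ (s8Solved : Set Stmt8Var)ᶜ := fun i =>
    X_mem_supported_compl_s8Solved (by simp [s8Solved, Fin.forall_fin_succ])
  have hd : ∀ i a, s8d i a ∈ supported ℂ (s8Solved : Set Stmt8Var)ᶜ := fun i a =>
    X_mem_supported_compl_s8Solved (by simp [s8Solved, Fin.forall_fin_succ])
  have hL : ∀ (i : Fin 2) α, s8L i.succ α ∈ supported ℂ (s8Solved : Set Stmt8Var)ᶜ :=
    fun i α => X_mem_supported_compl_s8Solved
      (by simp [s8Solved, Fin.forall_fin_succ, (Fin.succ_ne_zero _).symm])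
  have hQ0 : ∀ (a : Fin 2) α, s8Q 0 a.succ α ∈ supported ℂ (s8Solved : Set Stmt8Var)ᶜ :=
    fun a α => X_mem_supported_compl_s8Solved
      (by simp [s8Solved, Fin.forall_fin_succ, (Fin.succ_ne_zero _).symm])
  have hQ : ∀ (i : Fin 2) a α, s8Q i.succ a α ∈ supported ℂ (s8Solved : Set Stmt8Var)ᶜ :=
    fun i a α => X_mem_supported_compl_s8Solved
      (by simp [s8Solved, Fin.forall_fin_succ, (Fin.succ_ne_zero _).symm])
  have hsum : ∀ f : Fin 3 → Fin 3 → MvPolynomial Stmt8Var ℂ,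
      ∑ i, ∑ a, f i a = f 0 0 + ((∑ a : Fin 2, f 0 a.succ) + ∑ i : Fin 2, ∑ a, f i.succ a) :=
    fun f => by rw [Fin.sum_univ_succ, Fin.sum_univ_succ (f 0), add_assoc]
  have key := card_le_height_of_solvable s8I s8Solved fun x hx => by
    obtain ⟨⟨j, α⟩, -, rfl⟩ := Finset.mem_image.1 hx
    fin_cases j
    · exact ⟨1, 0, hone, one_mem _, zero_mem _, by
        rw [one_mul, add_zero]; exact hH α⟩
    · exact ⟨1, 0, hone, one_mem _, zero_mem _, by
        rw [one_mul, add_zero]; exact hHb α⟩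
    · refine ⟨s8u 0 0, (∑ a : Fin 2, s8u 0 a.succ * s8Q 0 a.succ α) +
        ∑ i : Fin 2, ∑ a, s8u i.succ a * s8Q i.succ a α, s8u_notMem 0 0, hu _ _,
        add_mem (sum_mem fun a _ => mul_mem (hu _ _) (hQ0 _ _))
          (sum_mem fun i _ => sum_mem fun a _ => mul_mem (hu _ _) (hQ _ _ _)), ?_⟩
      convert! sub_mem (hHb α) (hFb α) using 1
      rw [s8Fb, sub_sub_cancel, hsum fun i a => s8u i a * s8Q i a α]
      rfl
    · refine ⟨s8u 0 0 * s8e 0, s8u 0 0 * ((∑ i : Fin 2, s8e i.succ * s8L i.succ α) +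
          ((∑ a : Fin 2, s8d 0 a.succ * s8Q 0 a.succ α) +
            ∑ i : Fin 2, ∑ a, s8d i.succ a * s8Q i.succ a α)) -
        s8d 0 0 * ((∑ a : Fin 2, s8u 0 a.succ * s8Q 0 a.succ α) +
          ∑ i : Fin 2, ∑ a, s8u i.succ a * s8Q i.succ a α),
        fun h => (this.mem_or_mem h).elim (s8u_notMem 0 0) (s8e_notMem 0), mul_mem (hu _ _) (he _),
        sub_mem (mul_mem (hu _ _) (add_mem (sum_mem fun i _ => mul_mem (he _) (hL _ _))
          (add_mem (sum_mem fun a _ => mul_mem (hd _ _) (hQ0 _ _))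
            (sum_mem fun i _ => sum_mem fun a _ => mul_mem (hd _ _) (hQ _ _ _)))))
          (mul_mem (hd _ _) (add_mem (sum_mem fun a _ => mul_mem (hu _ _) (hQ0 _ _))
            (sum_mem fun i _ => sum_mem fun a _ => mul_mem (hu _ _) (hQ _ _ _)))), ?_⟩
      change s8u 0 0 * s8e 0 * s8L 0 α + _ ∈ s8I
      convert! sub_mem (s8I.mul_mem_left (s8u 0 0) (sub_mem (hF α) (hH α)))
        (s8I.mul_mem_left (s8d 0 0) (sub_mem (hHb α) (hFb α))) using 1
      rw [s8Fb, sub_sub_cancel, hsum fun i a => s8u i a * s8Q i a α, s8F_eq, add_sub_cancel_left,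
        Fin.sum_univ_succ (fun i => s8e i * s8L i α), hsum fun i a => s8d i a * s8Q i a α]
      ring
  rwa [card_s8Solved] at key

theorem ringKrullDim_mvPolynomial_s8 : ringKrullDim (MvPolynomial Stmt8Var ℂ) = 49 := by
  rw [MvPolynomial.ringKrullDim_of_isNoetherianRing, ringKrullDim_eq_zero_of_field, zero_add,
    Nat.card_eq_fintype_card]
  rfl

theorem le_ringKrullDim_quotient_s8I : 41 ≤ ringKrullDim (MvPolynomial Stmt8Var ℂ ⧸ s8I) := by
  let P := RingHom.ker (aeval 0 : MvPolynomial Stmt8Var ℂ →ₐ[ℂ] ℂ)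
  have : P.IsPrime := RingHom.ker_isPrime _
  have hle : s8I ≤ P := s8I_le_ker_aeval 0 (by simp) (by simp) (by simp) (by simp)
  have h49 : (49 : ℕ∞) ≤ P.height := by
    refine le_trans (by simp) (card_le_height_of_solvable P Finset.univ fun i _ =>
      ⟨1, 0, (Ideal.ne_top_iff_one _).1 this.ne_top, one_mem _, zero_mem _, by simp [P]⟩)
  have hspan := P.height_le_ringKrullDim_quotient_add_encard
    (Set.range ![s8H 0, s8H 1, s8Hb 0, s8Hb 1, s8F 0, s8F 1, s8Fb 0, s8Fb 1])
    (Ideal.span_le.1 (s8I_eq_span_range ▸ hle))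
  rw [← s8I_eq_span_range] at hspan
  have h : (49 : WithBot ℕ∞) ≤ ringKrullDim (MvPolynomial Stmt8Var ℂ ⧸ s8I) + 8 :=
    ((WithBot.coe_le_coe.2 h49).trans hspan).trans
      (add_le_add_right (WithBot.coe_le_coe.2 (encard_range_le _)) _)
  have h' : (41 : WithBot ℕ∞) + 8 ≤ ringKrullDim (MvPolynomial Stmt8Var ℂ ⧸ s8I) + 8 := by
    convert! h using 1
  exact (ENat.WithBot.add_le_add_natCast_right_iff (c := 8)).1 h'

theorem height_s8I_le_eight : s8I.height ≤ 8 := by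
  refine (s8I.height_le_spanFinrank s8I_isPrime.ne_top).trans ?_
  rw [s8I_eq_span_range]
  exact (Submodule.spanFinrank_span_le_encard _).trans (encard_range_le _)

/-- `I₃` is a prime complete intersection of height `8` in `ℂ[x₁,…,x₄₉]`;
equivalently its zero set is an irreducible affine variety of dimension `41`. -/
theorem stmt8 :
    ∃ hP : s8I.IsPrime,
      Order.height (⟨s8I, hP⟩ : PrimeSpectrum (MvPolynomial Stmt8Var ℂ)) = 8 ∧
      ringKrullDim (MvPolynomial Stmt8Var ℂ ⧸ s8I) = 41 := by
  have hP := s8I_isPrime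
  have hheight : s8I.height = 8 := le_antisymm height_s8I_le_eight eight_le_height_s8I
  refine ⟨hP, (PrimeSpectrum.height_eq_orderHeight ⟨s8I, hP⟩).symm.trans hheight,
    le_antisymm ?_ le_ringKrullDim_quotient_s8I⟩
  have h := ringKrullDim_quotient_add_height_le s8I
  rw [hheight, ringKrullDim_mvPolynomial_s8] at h
  have h' : ringKrullDim (MvPolynomial Stmt8Var ℂ ⧸ s8I) + 8 ≤ (41 : WithBot ℕ∞) + 8 := by
    convert! h using 1
  exact (ENat.WithBot.add_le_add_natCast_right_iff (c := 8)).1 h'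
end

section
/- In the polynomial ring ℂ[t, L¹₁,L¹₂,L²₁,L²₂,L³₁,L³₂, ẽ¹,ẽ²,ẽ³, H₁, d̃, Q variables], the two polynomials F₁ = H₁ + Σ_{i,a} d̃^i_a Q^i_{a,1} + Σᵢ Lⁱ₁ẽⁱ and G = Σᵢ (t·Lⁱ₁ − Lⁱ₂)·ẽⁱ form a regular sequence; hence their common zero locus U₂ is a complete intersection of codimension 2 in ℂ²⁹. -/
open MvPolynomial

/-- The 29 variables of the chart `U₂`: `t`, the nine `Q^i_{a,1}`, the six
`Lⁱ_α`, the three `ẽⁱ`, `H₁`, and the nine `d̃^i_a`. -/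
abbrev S12Var : Type :=
  Unit ⊕ (Fin 3 × Fin 3) ⊕ (Fin 3 × Fin 2) ⊕ Fin 3 ⊕ Unit ⊕ (Fin 3 × Fin 3)

noncomputable def s12t : MvPolynomial S12Var ℂ := X (Sum.inl ())
noncomputable def s12Q (i a : Fin 3) : MvPolynomial S12Var ℂ :=
  X (Sum.inr (Sum.inl (i, a)))
noncomputable def s12L (i : Fin 3) (α : Fin 2) : MvPolynomial S12Var ℂ :=
  X (Sum.inr (Sum.inr (Sum.inl (i, α))))
noncomputable def s12e (i : Fin 3) : MvPolynomial S12Var ℂ :=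
  X (Sum.inr (Sum.inr (Sum.inr (Sum.inl i))))
noncomputable def s12H1 : MvPolynomial S12Var ℂ :=
  X (Sum.inr (Sum.inr (Sum.inr (Sum.inr (Sum.inl ())))))
noncomputable def s12d (i a : Fin 3) : MvPolynomial S12Var ℂ :=
  X (Sum.inr (Sum.inr (Sum.inr (Sum.inr (Sum.inr (i, a))))))

/-- `F₁ = H₁ + Σ_{i,a} d̃^i_a Q^i_{a,1} + Σᵢ Lⁱ₁ ẽⁱ`. -/
noncomputable def s12F1 : MvPolynomial S12Var ℂ :=
  s12H1 + (∑ i : Fin 3, ∑ a : Fin 3, s12d i a * s12Q i a) +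
    ∑ i : Fin 3, s12L i 0 * s12e i

/-- `G = Σᵢ (t·Lⁱ₁ − Lⁱ₂)·ẽⁱ`. -/
noncomputable def s12G : MvPolynomial S12Var ℂ :=
  ∑ i : Fin 3, (s12t * s12L i 0 - s12L i 1) * s12e i

namespace MvPolynomial

variable {σ R : Type*} [CommRing R]

open Classical in
/-- The endomorphism of a polynomial ring sending the variables in `s` to zero. -/
noncomputable def killVars (s : Finset σ) : MvPolynomial σ R →ₐ[R] MvPolynomial σ R :=
  aeval fun i => if i ∈ s then 0 else X i

theorem killVars_X_of_mem {s : Finset σ} {i : σ} (hi : i ∈ s) :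
    killVars s (X i : MvPolynomial σ R) = 0 := by
  simp [killVars, hi]

theorem killVars_X_of_notMem {s : Finset σ} {i : σ} (hi : i ∉ s) :
    killVars s (X i : MvPolynomial σ R) = X i := by
  simp [killVars, hi]

theorem killVars_comp_of_subset {s t : Finset σ} (h : s ⊆ t) :
    (killVars t).comp (killVars s) = (killVars t : MvPolynomial σ R →ₐ[R] _) := by
  ext1 i
  by_cases hi : i ∈ s
  · simp [killVars_X_of_mem hi, killVars_X_of_mem (h hi)]
  · simp [killVars_X_of_notMem hi]

theorem ker_killVars_lt_of_ssubset [Nontrivial R] {s t : Finset σ} (h : s ⊂ t) :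
    RingHom.ker (killVars (R := R) s) < RingHom.ker (killVars (R := R) t) := by
  obtain ⟨i, hit, his⟩ := Finset.exists_of_ssubset h
  refine SetLike.lt_iff_le_and_exists.mpr ⟨fun p hp => ?_, X i, killVars_X_of_mem hit, fun hi => ?_⟩
  · rw [RingHom.mem_ker] at hp ⊢
    rw [← killVars_comp_of_subset h.subset, AlgHom.comp_apply, hp, map_zero]
  · rw [RingHom.mem_ker, killVars_X_of_notMem his] at hi
    exact X_ne_zero i hi

theorem card_le_height_ker_killVars [IsDomain R] (s : Finset σ) :
    (s.card : ℕ∞) ≤ (RingHom.ker (killVars (R := R) s)).height := by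
  induction s using Finset.cons_induction with
  | empty => simp
  | cons a s ha ih =>
    have : (RingHom.ker (killVars (R := R) s)).IsPrime := RingHom.ker_isPrime _
    have : (RingHom.ker (killVars (R := R) (s.cons a ha))).IsPrime := RingHom.ker_isPrime _
    calc ((s.cons a ha).card : ℕ∞) = s.card + 1 := by simp
      _ ≤ (RingHom.ker (killVars (R := R) s)).height + 1 := by gcongr
      _ ≤ _ := Ideal.height_add_one_le_of_lt_of_isPrime
          (ker_killVars_lt_of_ssubset (Finset.ssubset_cons ha))

/-- The principal ideal of `X i - q` is the kernel of the substitution `X i ↦ q`, when the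
substitution fixes `q`. -/
theorem span_X_sub_eq_ker_aeval_update [DecidableEq σ] (i : σ) (q : MvPolynomial σ R)
    (hq : aeval (Function.update X i q) q = q) :
    Ideal.span {X i - q} =
      RingHom.ker (aeval (Function.update X i q) : MvPolynomial σ R →ₐ[R] MvPolynomial σ R) := by
  apply le_antisymm
  · rw [Ideal.span_singleton_le_iff_mem, RingHom.mem_ker, map_sub, hq]
    simp
  · intro p hp
    have key : (Ideal.Quotient.mkₐ R (Ideal.span {X i - q})).comp
        (aeval (Function.update X i q)) = Ideal.Quotient.mkₐ R (Ideal.span {X i - q}) := by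
      ext1 j
      rcases eq_or_ne j i with rfl | hj
      · simp only [AlgHom.comp_apply, aeval_X, Function.update_self, Ideal.Quotient.mkₐ_eq_mk]
        exact (Ideal.Quotient.eq.mpr (Ideal.mem_span_singleton_self _)).symm
      · simp [hj]
    rw [← Ideal.Quotient.eq_zero_iff_mem, ← Ideal.Quotient.mkₐ_eq_mk R, ← key, AlgHom.comp_apply,
      RingHom.mem_ker.mp hp, map_zero]

end MvPolynomial

section TwoGenerators

variable {R : Type*} [CommRing R] [IsDomain R] {f g : R}

open scoped Pointwise in
theorem isRegular_pair_of_isPrime_span (hf : f ≠ 0) (hp : (Ideal.span {f}).IsPrime)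
    (hg : g ∉ Ideal.span {f}) (hne : Ideal.span {f, g} ≠ ⊤) :
    RingTheory.Sequence.IsRegular R [f, g] := by
  have hspan : f • (⊤ : Ideal R) = Ideal.span {f} := by
    rw [← Submodule.ideal_span_singleton_smul]; simp
  refine ⟨?_, ?_⟩
  · rw [RingTheory.Sequence.isWeaklyRegular_cons_iff,
      RingTheory.Sequence.isWeaklyRegular_singleton_iff]
    refine ⟨(IsRegular.of_ne_zero hf).left, ?_⟩
    refine (isSMulRegular_quotient_iff_mem_of_smul_mem _ _).mpr fun x hx => ?_
    rw [hspan] at hx ⊢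
    exact (hp.mem_or_mem hx).resolve_left hg
  · intro h
    apply hne
    rw [h, smul_eq_mul, Ideal.mul_top]
    simp [Ideal.ofList, Set.insert_def]

theorem ringKrullDim_quotient_pair_add_two_le (hf : f ≠ 0) (hp : (Ideal.span {f}).IsPrime)
    (hg : g ∉ Ideal.span {f}) :
    ringKrullDim (R ⧸ Ideal.span {f, g}) + 2 ≤ ringKrullDim R := by
  have hle : Ideal.span {f} ≤ Ideal.span {f, g} := Ideal.span_mono (by simp)
  have h₁ : ringKrullDim (R ⧸ Ideal.span {f, g}) + 1 ≤ ringKrullDim (R ⧸ Ideal.span {f}) := by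
    refine ringKrullDim_succ_le_of_surjective (Ideal.Quotient.factor hle)
      (Ideal.Quotient.factor_surjective hle) (r := Ideal.Quotient.mk _ g) ?_ ?_
    · rwa [mem_nonZeroDivisors_iff_ne_zero, Ne, Ideal.Quotient.eq_zero_iff_mem]
    · rw [Ideal.Quotient.factor_mk, Ideal.Quotient.eq_zero_iff_mem]
      exact Ideal.subset_span (by simp)
  have h₂ := ringKrullDim_quotient_succ_le_of_nonZeroDivisor
    (mem_nonZeroDivisors_of_ne_zero hf)
  calc ringKrullDim (R ⧸ Ideal.span {f, g}) + 2
      = ringKrullDim (R ⧸ Ideal.span {f, g}) + 1 + 1 := by rw [add_assoc, one_add_one_eq_two]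
    _ ≤ ringKrullDim (R ⧸ Ideal.span {f}) + 1 := by gcongr
    _ ≤ _ := h₂

end TwoGenerators

/-- The index of the variable `H₁`. -/
abbrev s12H1Index : S12Var := Sum.inr (Sum.inr (Sum.inr (Sum.inr (Sum.inl ()))))

theorem exists_s12F1_eq_sub : ∃ q : MvPolynomial S12Var ℂ, s12F1 = X s12H1Index - q ∧
    aeval (Function.update X s12H1Index q) q = q := by
  refine ⟨-((∑ i : Fin 3, ∑ a : Fin 3, s12d i a * s12Q i a) + ∑ i : Fin 3, s12L i 0 * s12e i),
    by simp only [s12F1, s12H1]; ring, ?_⟩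
  simp [s12d, s12Q, s12L, s12e]

theorem aeval_update_s12G (q : MvPolynomial S12Var ℂ) :
    aeval (Function.update X s12H1Index q) s12G = s12G := by
  simp [s12G, s12t, s12L, s12e]

theorem s12G_ne_zero : s12G ≠ 0 := by
  intro h
  have := congrArg (eval fun
    | Sum.inl _ => (1 : ℂ)
    | Sum.inr (Sum.inr (Sum.inl (i, α))) => if i = 0 ∧ α = 0 then 1 else 0
    | Sum.inr (Sum.inr (Sum.inr (Sum.inl _))) => 1
    | _ => 0) h
  simp [s12G, s12t, s12L, s12e, Fin.sum_univ_three] at this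

theorem s12F1_ne_zero : s12F1 ≠ 0 := by
  intro h
  have := congrArg (eval (Pi.single s12H1Index (1 : ℂ))) h
  simp [s12F1, s12H1, s12L, s12e, s12d, s12Q] at this

theorem isPrime_span_s12F1 : (Ideal.span {s12F1}).IsPrime := by
  obtain ⟨q, hF, hq⟩ := exists_s12F1_eq_sub
  rw [hF, span_X_sub_eq_ker_aeval_update _ q hq]
  exact RingHom.ker_isPrime _

theorem s12G_notMem_span_s12F1 : s12G ∉ Ideal.span {s12F1} := by
  obtain ⟨q, hF, hq⟩ := exists_s12F1_eq_sub
  rw [hF, span_X_sub_eq_ker_aeval_update _ q hq, RingHom.mem_ker]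
  exact fun h => s12G_ne_zero ((aeval_update_s12G q).symm.trans h)

theorem s12_pair_subset_ker_killVars :
    ({s12F1, s12G} : Set (MvPolynomial S12Var ℂ)) ⊆
      RingHom.ker (killVars (R := ℂ) (Finset.univ : Finset S12Var)) := by
  rintro p (rfl | rfl) <;>
    simp [RingHom.mem_ker, s12F1, s12G, s12H1, s12d, s12Q, s12L, s12e, killVars_X_of_mem]

theorem ringKrullDim_s12_quotient :
    ringKrullDim (MvPolynomial S12Var ℂ ⧸ Ideal.span {s12F1, s12G}) = 27 := by
  have hcard : Fintype.card S12Var = 29 := by simp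
  have hdim : ringKrullDim (MvPolynomial S12Var ℂ) = 29 := by
    rw [MvPolynomial.ringKrullDim_of_isNoetherianRing, ringKrullDim_eq_zero_of_field,
      Nat.card_eq_fintype_card, hcard]
    rfl
  have hupper := ringKrullDim_quotient_pair_add_two_le s12F1_ne_zero isPrime_span_s12F1
    s12G_notMem_span_s12F1
  have hprime : (RingHom.ker (killVars (R := ℂ) (Finset.univ : Finset S12Var))).IsPrime :=
    RingHom.ker_isPrime _
  have hheight := card_le_height_ker_killVars (R := ℂ) (Finset.univ : Finset S12Var)
  rw [Finset.card_univ, hcard] at hheight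
  have hlower := Ideal.height_le_ringKrullDim_quotient_add_encard _ s12_pair_subset_ker_killVars
  have hpair : ({s12F1, s12G} : Set (MvPolynomial S12Var ℂ)).encard ≤ 2 :=
    (Set.encard_insert_le _ _).trans_eq (by rw [Set.encard_singleton, one_add_one_eq_two])
  have hlower' : (29 : WithBot ℕ∞) ≤
      ringKrullDim (MvPolynomial S12Var ℂ ⧸ Ideal.span {s12F1, s12G}) + 2 := by
    calc (29 : WithBot ℕ∞)
        ≤ (RingHom.ker (killVars (R := ℂ) (Finset.univ : Finset S12Var))).height := by
          exact WithBot.coe_le_coe.mpr hheight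
      _ ≤ _ := hlower
      _ ≤ _ := by gcongr; exact WithBot.coe_le_coe.mpr hpair
  have heq := le_antisymm (hupper.trans_eq hdim) hlower'
  generalize ringKrullDim (MvPolynomial S12Var ℂ ⧸ Ideal.span {s12F1, s12G}) = d at heq
  induction d with
  | bot => simp at heq
  | coe d =>
    induction d with
    | top => exact absurd heq (by decide)
    | coe d =>
      have hd : d + 2 = 29 := Nat.cast_injective (R := ℕ∞) (WithBot.coe_injective heq)
      obtain rfl : d = 27 := by omega
      rfl

/-- `F₁` and `G` form a regular sequence; hence their common zero locus `U₂`
is a complete intersection of codimension `2` in `ℂ²⁹`. -/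
theorem stmt12 :
    RingTheory.Sequence.IsRegular (MvPolynomial S12Var ℂ) [s12F1, s12G] ∧
    ringKrullDim (MvPolynomial S12Var ℂ ⧸
      Ideal.span {s12F1, s12G}) = 27 := by
  refine ⟨isRegular_pair_of_isPrime_span s12F1_ne_zero isPrime_span_s12F1
    s12G_notMem_span_s12F1 fun h => ?_, ringKrullDim_s12_quotient⟩
  exact RingHom.ker_ne_top (killVars (R := ℂ) (Finset.univ : Finset S12Var))
    (top_le_iff.mp (h ▸ Ideal.span_le.mpr s12_pair_subset_ker_killVars))
end

section
/- In ℂ[H₁,H₂,H̄₁,H̄₂,Lⁱ_α,eⁱ] (i = 1,2,3; α = 1,2), let P₃ be the ideal generated by H̄₁,H̄₂,H₁,H₂ and the two forms Σᵢ Lⁱ₁eⁱ and Σᵢ Lⁱ₂eⁱ. Then P₃ is prime, and its zero locus is irreducible of codimension 6 (equivalently, the two bilinear forms Σᵢ Lⁱ₁eⁱ, Σᵢ Lⁱ₂eⁱ form a regular sequence in ℂ[Lⁱ_α, eⁱ]). -/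
open MvPolynomial

/-- The 13 variables `H_α, H̄_α, Lⁱ_α, eⁱ` of the electroweak sector. -/
abbrev S18Var : Type := Fin 2 ⊕ Fin 2 ⊕ (Fin 3 × Fin 2) ⊕ Fin 3

noncomputable def s18H (α : Fin 2) : MvPolynomial S18Var ℂ := X (Sum.inl α)
noncomputable def s18Hb (α : Fin 2) : MvPolynomial S18Var ℂ :=
  X (Sum.inr (Sum.inl α))
noncomputable def s18L (i : Fin 3) (α : Fin 2) : MvPolynomial S18Var ℂ :=
  X (Sum.inr (Sum.inr (Sum.inl (i, α))))
noncomputable def s18e (i : Fin 3) : MvPolynomial S18Var ℂ :=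
  X (Sum.inr (Sum.inr (Sum.inr i)))

/-- The ideal `P₃ = (H̄₁, H̄₂, H₁, H₂, Σᵢ Lⁱ₁eⁱ, Σᵢ Lⁱ₂eⁱ)`. -/
noncomputable def s18P3 : Ideal (MvPolynomial S18Var ℂ) :=
  Ideal.span {s18Hb 0, s18Hb 1, s18H 0, s18H 1,
    ∑ i : Fin 3, s18L i 0 * s18e i, ∑ i : Fin 3, s18L i 1 * s18e i}

namespace Electroweak

/-- The variables `Lⁱ_α` and `eⁱ`. -/
abbrev LEVar : Type := (Fin 3 × Fin 2) ⊕ Fin 3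

variable (k : Type*) [Field k]

/-- The bilinear form `Σᵢ Lⁱ_α eⁱ`. -/
noncomputable def leForm (α : Fin 2) : MvPolynomial LEVar k :=
  ∑ i : Fin 3, X (Sum.inl (i, α)) * X (Sum.inr i)

/-- The ideal generated by the two forms `Σᵢ Lⁱ_α eⁱ`. -/
noncomputable def leIdeal : Ideal (MvPolynomial LEVar k) :=
  Ideal.span {leForm k 0, leForm k 1}

variable {k}

lemma irreducible_X_mul_X_add {σ : Type*} {i j : σ} (hij : i ≠ j) {g : MvPolynomial σ k}
    (hg : i ∉ g.vars) (v : σ → k) (hv : v j = 0) (hgv : eval v g ≠ 0) :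
    Irreducible (X j * X i + g) := by
  refine irreducible_mul_X_add _ _ i (X_ne_zero j) (by simpa using hij) hg ?_
  rw [(X_prime (R := k) (i := j)).irreducible.isRelPrime_iff_not_dvd]
  rintro ⟨c, rfl⟩
  simp [hv] at hgv

lemma notMem_vars_X_mul_X {σ : Type*} {i a b : σ} (ha : i ≠ a) (hb : i ≠ b) :
    i ∉ (X a * X b : MvPolynomial σ k).vars := by
  classical
  intro h
  have := vars_mul _ _ h
  simp [ha, hb] at this

lemma prime_leForm (α : Fin 2) : Prime (leForm k α) := by
  classical
  rw [← irreducible_iff_prime]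
  have h := irreducible_X_mul_X_add (k := k) (i := (Sum.inl (0, α) : LEVar)) (j := Sum.inr 0)
    (g := X (Sum.inl (1, α)) * X (Sum.inr 1) + X (Sum.inl (2, α)) * X (Sum.inr 2))
    (by simp) (fun h => ?_)
    (fun s => if s = Sum.inl (1, α) ∨ s = Sum.inr 1 then 1 else 0) (by simp) (by simp)
  · have heq : leForm k α = X (Sum.inr 0) * X (Sum.inl (0, α)) +
        (X (Sum.inl (1, α)) * X (Sum.inr 1) + X (Sum.inl (2, α)) * X (Sum.inr 2)) := by
      rw [leForm, Fin.sum_univ_three]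
      ring
    rwa [heq]
  · rcases Finset.mem_union.1 (vars_add_subset _ _ h) with h | h
    · exact notMem_vars_X_mul_X (by simp) (by simp) h
    · exact notMem_vars_X_mul_X (by simp) (by simp) h

lemma prime_leForm_sub (α : Fin 2) :
    Prime (leForm k α - X (Sum.inl (2, α)) * X (Sum.inr 2)) := by
  classical
  rw [← irreducible_iff_prime]
  have h := irreducible_X_mul_X_add (k := k) (i := (Sum.inl (0, α) : LEVar)) (j := Sum.inr 0)
    (g := X (Sum.inl (1, α)) * X (Sum.inr 1))
    (by simp) (notMem_vars_X_mul_X (by simp) (by simp))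
    (fun s => if s = Sum.inl (1, α) ∨ s = Sum.inr 1 then 1 else 0) (by simp) (by simp)
  have heq : leForm k α - X (Sum.inl (2, α)) * X (Sum.inr 2) =
      X (Sum.inr 0) * X (Sum.inl (0, α)) + X (Sum.inl (1, α)) * X (Sum.inr 1) := by
    rw [leForm, Fin.sum_univ_three]
    ring
  rwa [heq]

lemma not_leForm_zero_dvd : ¬ leForm k 0 ∣ leForm k 1 := by
  rintro ⟨c, hc⟩
  have := congrArg (eval fun s : LEVar => if s = Sum.inl (0, 1) ∨ s = Sum.inr 0 then 1 else 0) hc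
  simp [leForm, Fin.sum_univ_three] at this

lemma not_leForm_sub_zero_dvd :
    ¬ (leForm k 0 - X (Sum.inl (2, 0)) * X (Sum.inr 2)) ∣
      (leForm k 1 - X (Sum.inl (2, 1)) * X (Sum.inr 2)) := by
  rintro ⟨c, hc⟩
  have := congrArg (eval fun s : LEVar => if s = Sum.inl (0, 1) ∨ s = Sum.inr 0 then 1 else 0) hc
  simp [leForm, Fin.sum_univ_three] at this

/-- Setting the variable `i` to zero does not change a polynomial modulo `X i`. -/
lemma X_dvd_sub_aeval_update {σ : Type*} [DecidableEq σ] (i : σ) (p : MvPolynomial σ k) :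
    X i ∣ p - aeval (Function.update (X : σ → MvPolynomial σ k) i 0) p := by
  rw [← Ideal.mem_span_singleton, ← Ideal.Quotient.mk_eq_mk_iff_sub_mem]
  have : (Ideal.Quotient.mkₐ k (Ideal.span {(X i : MvPolynomial σ k)})).comp
      (aeval (Function.update (X : σ → MvPolynomial σ k) i 0)) =
      Ideal.Quotient.mkₐ k (Ideal.span {(X i : MvPolynomial σ k)}) := by
    ext j
    by_cases h : j = i
    · subst h
      simp
    · simp [h]
  exact (DFunLike.congr_fun this p).symm

/-- `e³` is a nonzerodivisor modulo the two forms. -/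
lemma mem_leIdeal_of_X_mul_mem {g : MvPolynomial LEVar k}
    (h : X (Sum.inr 2) * g ∈ leIdeal k) : g ∈ leIdeal k := by
  obtain ⟨a, b, hab⟩ := Ideal.mem_span_pair.1 h
  set ρ := aeval (R := k) (Function.update (X : LEVar → MvPolynomial LEVar k) (Sum.inr 2) 0)
    with hρ
  have hform (α : Fin 2) : ρ (leForm k α) =
      leForm k α - X (Sum.inl (2, α)) * X (Sum.inr 2) := by
    simp [hρ, leForm, Fin.sum_univ_three]
  obtain ⟨a', ha'⟩ := X_dvd_sub_aeval_update (k := k) (Sum.inr 2) a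
  obtain ⟨b', hb'⟩ := X_dvd_sub_aeval_update (k := k) (Sum.inr 2) b
  rw [← hρ] at ha' hb'
  have hab' := congrArg ρ hab
  rw [map_add, map_mul, map_mul, map_mul, hform, hform,
    show ρ (X (Sum.inr 2)) = 0 by simp [hρ], zero_mul] at hab'
  obtain ⟨c, hc⟩ : (leForm k 0 - X (Sum.inl (2, 0)) * X (Sum.inr 2)) ∣ ρ b :=
    ((prime_leForm_sub 0).dvd_or_dvd ⟨-ρ a, by linear_combination hab'⟩).resolve_right
      not_leForm_sub_zero_dvd
  have hc' : ρ a = -(c * (leForm k 1 - X (Sum.inl (2, 1)) * X (Sum.inr 2))) := by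
    apply mul_right_cancel₀ (prime_leForm_sub (k := k) 0).ne_zero
    rw [hc] at hab'
    linear_combination hab'
  refine Ideal.mem_span_pair.2
    ⟨c * X (Sum.inl (2, 1)) + a', -(c * X (Sum.inl (2, 0))) + b', ?_⟩
  apply mul_left_cancel₀ (X_ne_zero (R := k) (Sum.inr 2 : LEVar))
  rw [← hab]
  linear_combination -(leForm k 0) * (ha' + hc') - (leForm k 1) * (hb' + hc)

lemma mem_leIdeal_of_X_pow_mul_mem {g : MvPolynomial LEVar k} (n : ℕ)
    (h : X (Sum.inr 2) ^ n * g ∈ leIdeal k) : g ∈ leIdeal k := by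
  induction n with
  | zero => simpa using h
  | succ n ih =>
    rw [pow_succ', mul_assoc] at h
    exact ih (mem_leIdeal_of_X_mul_mem h)

variable (k) in
/-- The parametrization of the common zero locus of the two forms obtained by solving for the
variables `L³_α` where `e³` does not vanish. -/
noncomputable def leParam : MvPolynomial LEVar k →ₐ[k] FractionRing (MvPolynomial LEVar k) :=
  aeval fun s => match s with
    | Sum.inl (2, α) =>
      -(algebraMap (MvPolynomial LEVar k) _
        (X (Sum.inl (0, α)) * X (Sum.inr 0) + X (Sum.inl (1, α)) * X (Sum.inr 1))) /
        algebraMap (MvPolynomial LEVar k) _ (X (Sum.inr 2))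
    | s => algebraMap (MvPolynomial LEVar k) _ (X s)

lemma leParam_leForm (α : Fin 2) : leParam k (leForm k α) = 0 := by
  have h2 : algebraMap (MvPolynomial LEVar k) (FractionRing (MvPolynomial LEVar k))
      (X (Sum.inr 2)) ≠ 0 := by simp
  simp only [leParam, leForm, Fin.sum_univ_three, map_add, map_mul, aeval_X]
  field_simp
  ring

lemma leIdeal_le_ker : leIdeal k ≤ RingHom.ker (leParam k) := by
  rw [leIdeal, Ideal.span_le]
  rintro _ (rfl | rfl) <;> exact leParam_leForm _

/-- Up to a power of `e³`, every polynomial is congruent modulo the two forms to one that is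
fixed by the parametrization. -/
lemma exists_X_pow_mul_sub_mem (p : MvPolynomial LEVar k) :
    ∃ (n : ℕ) (q : MvPolynomial LEVar k), leParam k q = algebraMap _ _ q ∧
      X (Sum.inr 2) ^ n * p - q ∈ leIdeal k := by
  induction p using MvPolynomial.induction_on with
  | C a => exact ⟨0, C a, by simp [leParam, IsScalarTower.algebraMap_apply k
      (MvPolynomial LEVar k) (FractionRing (MvPolynomial LEVar k)), algebraMap_eq], by simp⟩
  | add p₁ p₂ h₁ h₂ =>
    obtain ⟨n₁, q₁, hq₁, h₁⟩ := h₁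
    obtain ⟨n₂, q₂, hq₂, h₂⟩ := h₂
    refine ⟨n₁ + n₂, X (Sum.inr 2) ^ n₂ * q₁ + X (Sum.inr 2) ^ n₁ * q₂, ?_, ?_⟩
    · simp only [map_add, map_mul, map_pow, hq₁, hq₂]
      simp [leParam]
    · convert add_mem (Ideal.mul_mem_left _ (X (Sum.inr 2) ^ n₂) h₁)
        (Ideal.mul_mem_left _ (X (Sum.inr 2) ^ n₁) h₂) using 1
      ring
  | mul_X p s h =>
    obtain ⟨n₁, q₁, hq₁, h₁⟩ := h
    obtain ⟨n₂, q₂, hq₂, h₂⟩ : ∃ (n : ℕ) (q : MvPolynomial LEVar k),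
        leParam k q = algebraMap _ _ q ∧ X (Sum.inr 2) ^ n * X s - q ∈ leIdeal k := by
      match s with
      | Sum.inl (2, α) =>
        refine ⟨1, -(X (Sum.inl (0, α)) * X (Sum.inr 0) + X (Sum.inl (1, α)) * X (Sum.inr 1)),
          by simp [leParam], ?_⟩
        have hmem : leForm k α ∈ leIdeal k := by
          apply Ideal.subset_span
          fin_cases α <;> simp
        convert hmem using 1
        rw [leForm, Fin.sum_univ_three]
        ring
      | Sum.inl (0, α) => exact ⟨0, X (Sum.inl (0, α)), by simp [leParam], by simp⟩
      | Sum.inl (1, α) => exact ⟨0, X (Sum.inl (1, α)), by simp [leParam], by simp⟩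
      | Sum.inr i => exact ⟨0, X (Sum.inr i), by simp [leParam], by simp⟩
    refine ⟨n₁ + n₂, q₁ * q₂, by simp [hq₁, hq₂], ?_⟩
    convert add_mem (Ideal.mul_mem_right (X (Sum.inr 2) ^ n₂ * X s) _ h₁)
      (Ideal.mul_mem_left _ q₁ h₂) using 1
    ring

lemma leIdeal_eq_ker : leIdeal k = RingHom.ker (leParam k) := by
  refine le_antisymm leIdeal_le_ker fun p hp => ?_
  obtain ⟨n, q, hq, h⟩ := exists_X_pow_mul_sub_mem p
  have h0 := leIdeal_le_ker h
  rw [RingHom.mem_ker] at h0 hp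
  rw [map_sub, map_mul, hp, mul_zero, zero_sub, neg_eq_zero, hq] at h0
  have hq0 : q = 0 := by simpa using h0
  rw [hq0, sub_zero] at h
  exact mem_leIdeal_of_X_pow_mul_mem n h

instance isPrime_leIdeal : (leIdeal k).IsPrime := by
  rw [leIdeal_eq_ker]
  exact RingHom.ker_isPrime _

lemma seven_le_ringKrullDim_quotient_leIdeal :
    7 ≤ ringKrullDim (MvPolynomial LEVar k ⧸ leIdeal k) := by
  let ε : MvPolynomial LEVar k →ₐ[k] MvPolynomial (Fin 3 × Fin 2) k := aeval (Sum.elim X 0)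
  have hε : ∀ p ∈ leIdeal k, ε p = 0 := by
    change leIdeal k ≤ RingHom.ker ε
    rw [leIdeal, Ideal.span_le]
    rintro _ (rfl | rfl) <;> simp [ε, leForm, RingHom.mem_ker]
  have hsurj : Function.Surjective (Ideal.Quotient.lift (leIdeal k) ε.toRingHom hε) := by
    apply Ideal.Quotient.lift_surjective_of_surjective
    intro p
    refine ⟨rename Sum.inl p, ?_⟩
    simp [ε, bind₁_rename, Function.comp_def]
  have hne : Ideal.Quotient.mk (leIdeal k) (X (Sum.inr 2)) ≠ 0 := by
    rw [Ne, Ideal.Quotient.eq_zero_iff_mem]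
    intro h
    have := leIdeal_le_ker h
    simp [RingHom.mem_ker, leParam] at this
  have := ringKrullDim_succ_le_of_surjective _ hsurj (mem_nonZeroDivisors_of_ne_zero hne)
    (by simp [ε])
  rw [MvPolynomial.ringKrullDim_of_isNoetherianRing, ringKrullDim_eq_zero_of_field] at this
  simp only [Nat.card_eq_fintype_card, Fintype.card_prod, Fintype.card_fin] at this
  exact this

lemma ringKrullDim_quotient_leIdeal_le :
    ringKrullDim (MvPolynomial LEVar k ⧸ leIdeal k) ≤ 7 := by
  have hprime : (Ideal.span {leForm k 0}).IsPrime :=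
    (Ideal.span_singleton_prime (prime_leForm 0).ne_zero).2 (prime_leForm 0)
  have hle : Ideal.span {leForm k 0} ≤ leIdeal k := Ideal.span_mono (by simp)
  have hne : Ideal.Quotient.mk (Ideal.span {leForm k 0}) (leForm k 1) ≠ 0 := by
    rw [Ne, Ideal.Quotient.eq_zero_iff_mem, Ideal.mem_span_singleton]
    exact not_leForm_zero_dvd
  have h₁ := ringKrullDim_quotient_succ_le_of_nonZeroDivisor
    (mem_nonZeroDivisors_of_ne_zero (prime_leForm (k := k) 0).ne_zero)
  have h₂ := ringKrullDim_succ_le_of_surjective (Ideal.Quotient.factor hle)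
    (Ideal.Quotient.factor_surjective hle) (mem_nonZeroDivisors_of_ne_zero hne)
    (by
      rw [Ideal.Quotient.factor_mk, Ideal.Quotient.eq_zero_iff_mem]
      exact Ideal.subset_span (by simp))
  rw [MvPolynomial.ringKrullDim_of_isNoetherianRing, ringKrullDim_eq_zero_of_field] at h₁
  simp only [Nat.card_eq_fintype_card, Fintype.card_sum, Fintype.card_prod,
    Fintype.card_fin] at h₁
  have h₃ : ringKrullDim (MvPolynomial LEVar k ⧸ leIdeal k) + 1 + 1 ≤ 9 :=
    (add_le_add_left h₂ 1).trans (h₁.trans (by norm_num))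
  generalize ringKrullDim (MvPolynomial LEVar k ⧸ leIdeal k) = d at h₃ ⊢
  induction d with
  | bot => exact bot_le
  | coe d =>
    induction d with
    | top => exact absurd h₃ (by decide)
    | coe d =>
      have h₄ : ((d + 1 + 1 : ℕ) : ℕ∞) ≤ (9 : ℕ) := WithBot.coe_le_coe.1 h₃
      have h₅ : d ≤ 7 := by
        have := Nat.cast_le.1 h₄
        omega
      exact WithBot.coe_le_coe.2 (Nat.cast_le.2 h₅)

lemma isRegular_leForm :
    RingTheory.Sequence.IsRegular (MvPolynomial LEVar k) [leForm k 0, leForm k 1] := by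
  refine ⟨⟨fun i hi => ?_⟩, ?_⟩
  · rw [isSMulRegular_quotient_iff_mem_of_smul_mem]
    intro p hp
    rw [smul_eq_mul, Ideal.mul_top] at hp ⊢
    match i, hi with
    | 0, _ =>
      simpa [(prime_leForm (k := k) 0).ne_zero] using hp
    | 1, _ =>
      simp only [List.take_succ_cons, List.take_zero, Ideal.ofList_singleton,
        Ideal.mem_span_singleton] at hp ⊢
      exact ((prime_leForm 0).dvd_or_dvd hp).resolve_left not_leForm_zero_dvd
  · rw [smul_eq_mul, Ideal.mul_top]
    have : Ideal.ofList [leForm k 0, leForm k 1] = leIdeal k := by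
      simp [leIdeal, Ideal.ofList_cons, Ideal.span_insert]
    rw [this]
    exact (isPrime_leIdeal (k := k)).ne_top.symm

/-- The projection setting the variables `H_α` and `H̄_α` to zero. -/
noncomputable def forgetHiggs : MvPolynomial S18Var ℂ →ₐ[ℂ] MvPolynomial LEVar ℂ :=
  aeval (Sum.elim 0 (Sum.elim 0 X))

/-- The inclusion of `ℂ[Lⁱ_α, eⁱ]` into the full polynomial ring. -/
noncomputable def inclLE : MvPolynomial LEVar ℂ →ₐ[ℂ] MvPolynomial S18Var ℂ :=
  rename fun s => Sum.inr (Sum.inr s)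

lemma forgetHiggs_inclLE (p : MvPolynomial LEVar ℂ) : forgetHiggs (inclLE p) = p := by
  simp [forgetHiggs, inclLE, bind₁_rename, Function.comp_def]

lemma inclLE_leForm (α : Fin 2) : inclLE (leForm ℂ α) = ∑ i : Fin 3, s18L i α * s18e i := by
  simp [inclLE, leForm, s18L, s18e]

lemma sub_inclLE_forgetHiggs_mem (p : MvPolynomial S18Var ℂ) :
    p - inclLE (forgetHiggs p) ∈ s18P3 := by
  rw [← Ideal.Quotient.mk_eq_mk_iff_sub_mem]
  have : (Ideal.Quotient.mkₐ ℂ s18P3).comp (inclLE.comp forgetHiggs) =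
      Ideal.Quotient.mkₐ ℂ s18P3 := by
    ext s
    rcases s with α | α | s
    · have : (X (Sum.inl α) : MvPolynomial S18Var ℂ) ∈ s18P3 := by
        apply Ideal.subset_span
        fin_cases α <;> simp [s18H]
      simp [forgetHiggs, Ideal.Quotient.eq_zero_iff_mem.2 this]
    · have : (X (Sum.inr (Sum.inl α)) : MvPolynomial S18Var ℂ) ∈ s18P3 := by
        apply Ideal.subset_span
        fin_cases α <;> simp [s18Hb]
      simp [forgetHiggs, Ideal.Quotient.eq_zero_iff_mem.2 this]
    · simp [forgetHiggs, inclLE]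
  exact (DFunLike.congr_fun this p).symm

lemma s18P3_eq_comap : s18P3 = (leIdeal ℂ).comap forgetHiggs := by
  apply le_antisymm
  · rw [s18P3, Ideal.span_le]
    have hform (α : Fin 2) :
        forgetHiggs (∑ i : Fin 3, s18L i α * s18e i) = leForm ℂ α := by
      rw [← inclLE_leForm, forgetHiggs_inclLE]
    rintro _ (rfl | rfl | rfl | rfl | rfl | rfl) <;>
      rw [SetLike.mem_coe, Ideal.mem_comap]
    · simp [s18Hb, forgetHiggs]
    · simp [s18Hb, forgetHiggs]
    · simp [s18H, forgetHiggs]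
    · simp [s18H, forgetHiggs]
    · rw [hform]
      exact Ideal.subset_span (by simp)
    · rw [hform]
      exact Ideal.subset_span (by simp)
  · intro p hp
    have hle : leIdeal ℂ ≤ s18P3.comap inclLE := by
      rw [leIdeal, Ideal.span_le]
      rintro _ (rfl | rfl) <;>
        rw [SetLike.mem_coe, Ideal.mem_comap, inclLE_leForm] <;>
        exact Ideal.subset_span (by simp)
    simpa using add_mem (sub_inclLE_forgetHiggs_mem p) (hle hp)

lemma ringKrullDim_quotient_s18P3 :
    ringKrullDim (MvPolynomial S18Var ℂ ⧸ s18P3) =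
      ringKrullDim (MvPolynomial LEVar ℂ ⧸ leIdeal ℂ) := by
  let φ := (Ideal.Quotient.mk (leIdeal ℂ)).comp forgetHiggs.toRingHom
  have hφ : Function.Surjective φ :=
    Ideal.Quotient.mk_surjective.comp fun p => ⟨inclLE p, forgetHiggs_inclLE p⟩
  have hker : s18P3 = RingHom.ker φ := by
    rw [s18P3_eq_comap]
    ext p
    simp [φ, RingHom.mem_ker, Ideal.Quotient.eq_zero_iff_mem]
  rw [hker]
  exact ringKrullDim_eq_of_ringEquiv (RingHom.quotientKerEquivOfSurjective hφ)

end Electroweak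

/-- `P₃` is prime, its zero locus is irreducible of codimension `6` (the
quotient ring has Krull dimension `13 − 6 = 7`), and the two bilinear forms
`Σᵢ Lⁱ₁eⁱ, Σᵢ Lⁱ₂eⁱ` form a regular sequence in `ℂ[Lⁱ_α, eⁱ]`. -/
theorem stmt18 :
    s18P3.IsPrime ∧
    ringKrullDim (MvPolynomial S18Var ℂ ⧸ s18P3) = 7 ∧
    RingTheory.Sequence.IsRegular (MvPolynomial ((Fin 3 × Fin 2) ⊕ Fin 3) ℂ)
      [∑ i : Fin 3, (X (Sum.inl (i, 0)) : MvPolynomial ((Fin 3 × Fin 2) ⊕ Fin 3) ℂ)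
          * X (Sum.inr i),
       ∑ i : Fin 3, X (Sum.inl (i, 1)) * X (Sum.inr i)] := by
  refine ⟨?_, ?_, Electroweak.isRegular_leForm⟩
  · rw [Electroweak.s18P3_eq_comap]
    exact Ideal.comap_isPrime _ _
  · rw [Electroweak.ringKrullDim_quotient_s18P3]
    exact le_antisymm Electroweak.ringKrullDim_quotient_leIdeal_le
      Electroweak.seven_le_ringKrullDim_quotient_leIdeal
end
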